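/- arXiv:1506.08472 — 6 statements merged into one kernel-verified Lean document; each statement's English description precedes it below -/
import Mathlib

section
/- Let k ≥ 1, let D ⊆ ℝ^k be a nonempty compact convex set, and let H : ℝ^k → ℝ^k be continuous on D. Then there exists x ∈ D such that ⟨H(x), y − x⟩ ≥ 0 for all y ∈ D (Hartman–Stampacchia: a continuous map on a nonempty compact convex subset of ℝ^k admits a solution of the associated variational inequality). -/
open scoped RealInnerProductSpace

open MeasureTheory Set Polynomial

/-- A family of integrals depending polynomially on a parameter is constant as soon as it is
constant on an interval. -/
lemma integral_eq_of_forall_exists_polynomial {α : Type*} [MeasurableSpace α] {μ : Measure α}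
    {f : ℝ → α → ℝ} (hf : ∀ t, Integrable (f t) μ) {N : ℕ}
    (hp : ∀ x, ∃ p : ℝ[X], p.natDegree ≤ N ∧ ∀ t, f t x = p.eval t)
    {c ε : ℝ} (hε : 0 < ε) (hc : ∀ t ∈ Icc 0 ε, ∫ x, f t x ∂μ = c) (t : ℝ) :
    ∫ x, f t x ∂μ = c := by
  obtain ⟨s, hs, hcard⟩ := (Icc_infinite hε).exists_subset_card_eq (N + 1)
  have hinj : InjOn (id : ℝ → ℝ) s := injOn_id _
  have hne : s.Nonempty := Finset.card_pos.mp (by omega)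
  have key : ∀ x, f t x = ∑ i ∈ s, f i x * (Lagrange.basis s id i).eval t := by
    intro x
    obtain ⟨p, hdeg, hpx⟩ := hp x
    have hlt : p.degree < (s.card : WithBot ℕ) := by
      rw [hcard]
      exact (degree_le_natDegree).trans_lt (by exact_mod_cast Nat.lt_succ_of_le hdeg)
    have h := congrArg (eval t) (Lagrange.eq_interpolate hinj hlt)
    rw [hpx t, h, Lagrange.interpolate_apply]
    simp [eval_finsetSum, hpx]
  have hsum : ∑ i ∈ s, (Lagrange.basis s id i).eval t = 1 := by
    rw [← eval_finsetSum, Lagrange.sum_basis hinj hne, eval_one]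
  simp_rw [key]
  rw [integral_finsetSum _ fun i _ => (hf i).mul_const _]
  simp_rw [integral_mul_const]
  rw [Finset.sum_congr rfl fun i hi => by rw [hc i (hs hi)], ← Finset.mul_sum, hsum, mul_one]

lemma bijective_id_add_of_lipschitzWith {E : Type*} [NormedAddCommGroup E] [CompleteSpace E] {g : E → E} {K : NNReal}
    (hK : K < 1) (hg : LipschitzWith K g) : Function.Bijective fun x => x + g x := by
  constructor
  · intro x y hxy
    have h : x - y = g y - g x := by
      have : x + g x = y + g y := hxy
      rw [sub_eq_sub_iff_add_eq_add, this, add_comm]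
    have h1 := hg.norm_sub_le y x
    rw [← h, norm_sub_rev y x] at h1
    have : (K : ℝ) < 1 := hK
    have : ‖x - y‖ = 0 := by nlinarith [norm_nonneg (x - y)]
    exact sub_eq_zero.mp (norm_eq_zero.mp this)
  · intro y
    have hc : ContractingWith K fun x => y - g x :=
      ⟨hK, LipschitzWith.of_dist_le_mul fun a b => by
        simpa only [dist_sub_left] using hg.dist_le_mul a b⟩
    exact ⟨hc.fixedPoint, by
      have h : y - g hc.fixedPoint = hc.fixedPoint := hc.fixedPoint_isFixedPt
      exact (sub_eq_iff_eq_add.mp h).symm⟩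

lemma Function.Bijective.image_eq_of_eq_self_off {α : Type*} {f : α → α} (hf : f.Bijective)
    {s : Set α} (hs : ∀ x ∉ s, f x = x) : f '' s = s := by
  apply Subset.antisymm
  · rintro _ ⟨x, hx, rfl⟩
    by_contra h
    exact h (by rwa [hf.injective (hs _ h)])
  · intro y hy
    obtain ⟨x, rfl⟩ := hf.surjective y
    refine ⟨x, ?_, rfl⟩
    by_contra h
    exact h (hs x h ▸ hy)

section

variable {E : Type*} [NormedAddCommGroup E] [InnerProductSpace ℝ E] [FiniteDimensional ℝ E]

lemma ContinuousLinearMap.exists_polynomial_det_one_add_smul (A : E →L[ℝ] E) :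
    ∃ p : ℝ[X], p.natDegree ≤ Module.finrank ℝ E ∧ ∀ t : ℝ, (1 + t • A).det = p.eval t := by
  classical
  let b := Module.finBasis ℝ E
  let M := LinearMap.toMatrix b b (A : E →ₗ[ℝ] E)
  refine ⟨_, (natDegree_det_X_add_C_le M 1).trans_eq (Fintype.card_fin _), fun t => ?_⟩
  have : (1 + t • A).det = (1 + t • M).det := by
    rw [ContinuousLinearMap.det, ← LinearMap.det_toMatrix b]
    congr 1
    simp [M, LinearMap.toMatrix_one]
  rw [this, ← coe_evalRingHom, RingHom.map_det]
  congr 1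
  ext i j
  simp [Matrix.one_apply, add_comm, apply_ite]
  exact mul_comm _ _

lemma ContinuousLinearMap.det_one_add_smul_pos {A : E →L[ℝ] E} {t : ℝ} (ht : 0 ≤ t)
    (htA : t * ‖A‖ < 1) : 0 < (1 + t • A).det := by
  by_contra! hneg
  have hcont : ContinuousOn (fun s : ℝ => (1 + s • A).det) (Icc 0 t) := by
    obtain ⟨p, -, hp⟩ := A.exists_polynomial_det_one_add_smul
    simp_rw [hp]
    exact p.continuous.continuousOn
  obtain ⟨s, ⟨hs0, hst⟩, hs⟩ := intermediate_value_Icc' ht hcont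
    (show (0 : ℝ) ∈ Icc _ _ from ⟨hneg, by simp [ContinuousLinearMap.det]⟩)
  have hker := LinearMap.bot_lt_ker_of_det_eq_zero (f := ((1 + s • A : E →L[ℝ] E) : E →ₗ[ℝ] E)) hs
  obtain ⟨v, hv, hv0⟩ := (Submodule.ne_bot_iff _).mp hker.ne'
  have hv' : v = -(s • A v) := eq_neg_of_add_eq_zero_left (by simpa using hv)
  have hpos : 0 < ‖v‖ := norm_pos_iff.mpr hv0
  have h1 : ‖v‖ ≤ s * (‖A‖ * ‖v‖) := by
    calc ‖v‖ = s * ‖A v‖ := by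
          conv_lhs => rw [hv']
          rw [norm_neg, norm_smul, Real.norm_of_nonneg hs0]
      _ ≤ _ := by gcongr; exact A.le_opNorm v
  have h2 : s * ‖A‖ ≤ t * ‖A‖ := by gcongr
  nlinarith

variable [MeasurableSpace E] [BorelSpace E]

/-- The degree formula for a compactly supported perturbation of the identity, tested against
the powers of `R ^ 2 - ‖y‖ ^ 2`. -/
lemma integral_pow_mul_det_id_add {g : E → E} (hg : ContDiff ℝ 1 g) {R : ℝ}
    (hsupp : ∀ x ∉ Metric.closedBall (0 : E) R, g x = 0) (m : ℕ) :
    ∫ x in Metric.closedBall (0 : E) R, (R ^ 2 - ‖x + g x‖ ^ 2) ^ m * (1 + fderiv ℝ g x).det =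
      ∫ y in Metric.closedBall (0 : E) R, (R ^ 2 - ‖y‖ ^ 2) ^ m := by
  have hcs : HasCompactSupport g :=
    HasCompactSupport.intro (isCompact_closedBall (0 : E) R) hsupp
  obtain ⟨K, hK⟩ := hg.lipschitzWith_of_hasCompactSupport hcs one_ne_zero
  have hdet : Continuous fun L : E →L[ℝ] E => L.det := ContinuousLinearMap.continuous_det
  have hg' : Continuous (fderiv ℝ g) := hg.continuous_fderiv one_ne_zero
  have hgc : Continuous g := hg.continuous
  have main := integral_eq_of_forall_exists_polynomial
    (μ := volume.restrict (Metric.closedBall (0 : E) R))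
    (f := fun t x => (R ^ 2 - ‖x + t • g x‖ ^ 2) ^ m * (1 + t • fderiv ℝ g x).det)
    (N := 2 * m + Module.finrank ℝ E)
    (c := ∫ y in Metric.closedBall (0 : E) R, (R ^ 2 - ‖y‖ ^ 2) ^ m)
    (ε := (2 * (K + 1))⁻¹) ?_ ?_ (by positivity) ?_ 1
  · simpa using main
  · intro t
    refine ContinuousOn.integrableOn_compact (isCompact_closedBall _ _) (Continuous.continuousOn ?_)
    exact (by fun_prop : Continuous fun x => (R ^ 2 - ‖x + t • g x‖ ^ 2) ^ m).mul
      (hdet.comp (by fun_prop))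
  · intro x
    obtain ⟨p, hdeg, hp⟩ := (fderiv ℝ g x).exists_polynomial_det_one_add_smul
    let q : ℝ[X] := C (-‖g x‖ ^ 2) * X ^ 2 + C (-2 * ⟪x, g x⟫) * X + C (R ^ 2 - ‖x‖ ^ 2)
    have hq : q.natDegree ≤ 2 := natDegree_quadratic_le
    refine ⟨q ^ m * p, ?_, fun t => ?_⟩
    · refine natDegree_mul_le.trans (add_le_add ?_ hdeg)
      refine natDegree_pow_le.trans ?_
      rw [mul_comm]; gcongr
    · rw [hp, eval_mul, eval_pow]
      congr 2
      simp only [q, norm_add_sq_real, norm_smul, inner_smul_right, mul_pow, Real.norm_eq_abs,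
        sq_abs]
      simp
      ring
  · rintro t ⟨ht0, ht⟩
    have htK : t * K < 1 := by
      have h := mul_le_mul_of_nonneg_right ht (by positivity : (0 : ℝ) ≤ 2 * (K + 1))
      rw [inv_mul_cancel₀ (by positivity)] at h
      nlinarith [K.coe_nonneg]
    have hlip : LipschitzWith (t.toNNReal * K) fun x => t • g x := by
      refine LipschitzWith.of_dist_le_mul fun a b => ?_
      rw [dist_smul₀, Real.norm_of_nonneg ht0, NNReal.coe_mul, Real.coe_toNNReal _ ht0, mul_assoc]
      gcongr
      exact hK.dist_le_mul a b
    have hbij := bijective_id_add_of_lipschitzWith (by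
      rwa [← NNReal.coe_lt_coe, NNReal.coe_mul, Real.coe_toNNReal _ ht0, NNReal.coe_one]) hlip
    have himg := hbij.image_eq_of_eq_self_off (s := Metric.closedBall 0 R)
      fun x hx => by simp [hsupp x hx]
    have hderiv : ∀ x ∈ Metric.closedBall (0 : E) R,
        HasFDerivWithinAt (fun x => x + t • g x) (1 + t • fderiv ℝ g x)
          (Metric.closedBall 0 R) x := fun x _ =>
      ((hasFDerivAt_id x).add
        (((hg.differentiable one_ne_zero) x).hasFDerivAt.const_smul t)).hasFDerivWithinAt
    have hcv := integral_image_eq_integral_abs_det_fderiv_smul volume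
      Metric.isClosed_closedBall.measurableSet hderiv hbij.injective.injOn
      fun y => (R ^ 2 - ‖y‖ ^ 2) ^ m
    rw [himg] at hcv
    rw [hcv]
    refine integral_congr_ae (Filter.Eventually.of_forall fun x => ?_)
    have hpos : 0 < (1 + t • fderiv ℝ g x).det :=
      ContinuousLinearMap.det_one_add_smul_pos ht0 <|
        (mul_le_mul_of_nonneg_left (norm_fderiv_le_of_lipschitz ℝ hK) ht0).trans_lt htK
    simp only [abs_of_pos hpos, smul_eq_mul, mul_comm]

/-- A compactly supported `C¹` perturbation of the identity has a zero. -/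
lemma exists_add_eq_zero_of_contDiff {g : E → E} (hg : ContDiff ℝ 1 g)
    (hcs : HasCompactSupport g) : ∃ x, x + g x = 0 := by
  obtain ⟨r, hr⟩ := hcs.isCompact.isBounded.subset_closedBall 0
  obtain ⟨M, hM⟩ := hcs.exists_bound_of_continuous hg.continuous
  obtain ⟨R, hrR, hR⟩ : ∃ R, |r| + M ≤ R ∧ 0 < R := ⟨max (|r| + M) 1, le_max_left _ _, by simp⟩
  have hM0 : 0 ≤ M := (norm_nonneg _).trans (hM 0)
  have hsupp : ∀ x : E, r < ‖x‖ → g x = 0 := fun x hx => by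
    by_contra h
    exact hx.not_ge (by simpa using hr (subset_tsupport g h))
  have hself : ∀ x ∈ Metric.closedBall (0 : E) R, ‖x + g x‖ ≤ R := by
    intro x hx
    rcases lt_or_ge r ‖x‖ with h | h
    · simpa [hsupp x h] using hx
    · linarith [norm_add_le x (g x), hM x, le_abs_self r]
  have hB : IsCompact (Metric.closedBall (0 : E) R) := isCompact_closedBall _ _
  have hgc : Continuous g := hg.continuous
  obtain ⟨x₀, hx₀, hmin⟩ := hB.exists_isMinOn ⟨0, by simpa using hR.le⟩
    (by fun_prop : Continuous fun x => ‖x + g x‖).continuousOn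
  refine ⟨x₀, ?_⟩
  by_contra hne
  set δ := ‖x₀ + g x₀‖
  have hδ0 : 0 < δ := norm_pos_iff.mpr hne
  have hδR : δ ≤ R := hself x₀ hx₀
  have hid := integral_pow_mul_det_id_add hg (R := R) fun x hx => hsupp x <| by
    have : R < ‖x‖ := by simpa using hx
    linarith [le_abs_self r]
  set a := R ^ 2 - δ ^ 2
  set b := R ^ 2 - (δ / 2) ^ 2
  have ha : 0 ≤ a := by simp only [a]; nlinarith
  have hab : a < b := by simp only [a, b]; nlinarith
  have hb : 0 < b := ha.trans_lt hab
  have hg' : Continuous (fderiv ℝ g) := hg.continuous_fderiv one_ne_zero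
  have hdet : Continuous fun x => (1 + fderiv ℝ g x).det :=
    ContinuousLinearMap.continuous_det.comp (by fun_prop)
  set C := ∫ x in Metric.closedBall (0 : E) R, |(1 + fderiv ℝ g x).det|
  set v := volume.real (Metric.closedBall (0 : E) (δ / 2))
  have hv : 0 < v := ENNReal.toReal_pos (Metric.measure_closedBall_pos _ _ (by positivity)).ne'
    measure_closedBall_lt_top.ne
  have upper : ∀ m : ℕ, ∫ x in Metric.closedBall (0 : E) R,
      (R ^ 2 - ‖x + g x‖ ^ 2) ^ m * (1 + fderiv ℝ g x).det ≤ a ^ m * C := by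
    intro m
    rw [← integral_const_mul]
    refine setIntegral_mono_on (ContinuousOn.integrableOn_compact hB (Continuous.continuousOn ?_))
      (ContinuousOn.integrableOn_compact hB (Continuous.continuousOn ?_)) hB.measurableSet fun x hx => ?_
    · fun_prop
    · fun_prop
    · have h1 : ‖x + g x‖ ≤ R := hself x hx
      have h2 : δ ≤ ‖x + g x‖ := hmin hx
      have h3 : 0 ≤ R ^ 2 - ‖x + g x‖ ^ 2 := by nlinarith [norm_nonneg (x + g x)]
      have h4 : R ^ 2 - ‖x + g x‖ ^ 2 ≤ a := by simp only [a]; nlinarith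
      calc _ ≤ (R ^ 2 - ‖x + g x‖ ^ 2) ^ m * |(1 + fderiv ℝ g x).det| := by
            gcongr; exact le_abs_self _
        _ ≤ _ := by gcongr
  have lower : ∀ m : ℕ, b ^ m * v ≤
      ∫ y in Metric.closedBall (0 : E) R, (R ^ 2 - ‖y‖ ^ 2) ^ m := by
    intro m
    have hint : ∀ s : Set E, IsCompact s → IntegrableOn (fun y => (R ^ 2 - ‖y‖ ^ 2) ^ m) s :=
      fun s hs => ContinuousOn.integrableOn_compact hs (by fun_prop)
    have hB' : IsCompact (Metric.closedBall (0 : E) (δ / 2)) := isCompact_closedBall _ _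
    calc b ^ m * v = ∫ _ in Metric.closedBall (0 : E) (δ / 2), b ^ m := by
          rw [setIntegral_const, smul_eq_mul, mul_comm]
      _ ≤ ∫ y in Metric.closedBall (0 : E) (δ / 2), (R ^ 2 - ‖y‖ ^ 2) ^ m := by
          refine setIntegral_mono_on (integrableOn_const hB'.measure_lt_top.ne) (hint _ hB')
            hB'.measurableSet fun y hy => ?_
          have hy' : ‖y‖ ≤ δ / 2 := by simpa using hy
          refine pow_le_pow_left₀ hb.le ?_ m
          simp only [b]; gcongr
      _ ≤ _ := by
          refine setIntegral_mono_set (hint _ hB) ?_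
            (Metric.closedBall_subset_closedBall (by linarith)).eventuallyLE
          filter_upwards [ae_restrict_mem hB.measurableSet] with y hy
          have hy' : ‖y‖ ≤ R := by simpa using hy
          exact pow_nonneg (by nlinarith [norm_nonneg y]) m
  have hle : ∀ m : ℕ, v ≤ (a / b) ^ m * C := fun m => by
    have h := (lower m).trans ((hid m).symm.trans_le (upper m))
    rw [div_pow, div_mul_eq_mul_div, le_div_iff₀ (by positivity), mul_comm]
    exact h
  have hlim : Filter.Tendsto (fun m : ℕ => (a / b) ^ m * C) Filter.atTop (nhds (0 * C)) :=
    (tendsto_pow_atTop_nhds_zero_of_lt_one (by positivity) ((div_lt_one hb).mpr hab)).mul_const C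
  have := ge_of_tendsto' hlim hle
  linarith

/-- A bounded continuous perturbation of the identity has a zero. -/
lemma exists_add_eq_zero_of_continuous_of_bounded {g : E → E} (hg : Continuous g) {M : ℝ}
    (hM : ∀ x, ‖g x‖ ≤ M) : ∃ x, x + g x = 0 := by
  have hM0 : 0 ≤ M := (norm_nonneg _).trans (hM 0)
  let χ : ContDiffBump (0 : E) := ⟨M + 1, M + 2, by linarith, by linarith⟩
  have hχg : Continuous fun x => χ x • g x := χ.continuous.smul hg
  have approx : ∀ ε : ℝ, 0 < ε → ε ≤ 1 →
      ∃ z ∈ Metric.closedBall (0 : E) (M + 1), ‖z + g z‖ ≤ ε := by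
    intro ε hε hε1
    obtain ⟨f, hf, hdist, hsupp⟩ :=
      hχg.exists_contDiff_approx 1 (ε := fun _ => ε) continuous_const fun _ => hε
    have hcs : HasCompactSupport f :=
      (χ.hasCompactSupport.smul_right (f' := g)).mono hsupp
    obtain ⟨z, hz⟩ := exists_add_eq_zero_of_contDiff hf hcs
    have hfz : f z = -z := (neg_eq_of_add_eq_zero_right hz).symm
    have hd : ‖z + χ z • g z‖ < ε := by
      have := hdist z
      rwa [hfz, dist_eq_norm, ← neg_add', norm_neg] at this
    have hχM : ‖χ z • g z‖ ≤ M := by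
      rw [norm_smul, Real.norm_of_nonneg χ.nonneg]
      exact (mul_le_of_le_one_left (norm_nonneg _) χ.le_one).trans (hM z)
    have hzM : z ∈ Metric.closedBall (0 : E) (M + 1) := by
      rw [mem_closedBall_zero_iff]
      have := norm_sub_le (z + χ z • g z) (χ z • g z)
      rw [add_sub_cancel_right] at this
      linarith
    refine ⟨z, hzM, ?_⟩
    rw [χ.one_of_mem_closedBall hzM, one_smul] at hd
    exact hd.le
  obtain ⟨x₀, hx₀, hmin⟩ := (isCompact_closedBall (0 : E) (M + 1)).exists_isMinOn
    ⟨0, by simp; linarith⟩ (by fun_prop : Continuous fun x => ‖x + g x‖).continuousOn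
  refine ⟨x₀, ?_⟩
  by_contra hne
  have hpos : 0 < ‖x₀ + g x₀‖ := norm_pos_iff.mpr hne
  obtain ⟨z, hz, hzle⟩ := approx (min 1 (‖x₀ + g x₀‖ / 2)) (by positivity) (min_le_left _ _)
  have h1 : ‖x₀ + g x₀‖ ≤ ‖z + g z‖ := hmin hz
  linarith [min_le_right 1 (‖x₀ + g x₀‖ / 2)]

end

/-- The metric projection onto a nonempty complete convex set. -/
lemma Convex.exists_lipschitzWith_projection {E : Type*} [NormedAddCommGroup E]
    [InnerProductSpace ℝ E] {D : Set E} (hconv : Convex ℝ D) (hne : D.Nonempty)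
    (hD : IsComplete D) :
    ∃ P : E → E, LipschitzWith 1 P ∧ (∀ z, P z ∈ D) ∧ ∀ z, ∀ y ∈ D, ⟪z - P z, y - P z⟫ ≤ 0 := by
  choose P hPD hP using exists_norm_eq_iInf_of_complete_convex hne hD hconv
  have hvar : ∀ z, ∀ y ∈ D, ⟪z - P z, y - P z⟫ ≤ 0 := fun z =>
    (norm_eq_iInf_iff_real_inner_le_zero hconv (hPD z)).mp (hP z)
  refine ⟨P, LipschitzWith.of_dist_le_mul fun x y => ?_, hPD, hvar⟩
  rw [dist_eq_norm, dist_eq_norm, NNReal.coe_one, one_mul]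
  have h1 := hvar x (P y) (hPD y)
  have h2 := hvar y (P x) (hPD x)
  have h3 : ⟪x - P x, P y - P x⟫ + ⟪y - P y, P x - P y⟫ =
      ‖P x - P y‖ ^ 2 - ⟪x - y, P x - P y⟫ := by
    rw [← real_inner_self_eq_norm_sq]
    simp only [inner_sub_left, inner_sub_right]
    ring
  have h4 := real_inner_le_norm (x - y) (P x - P y)
  rcases (norm_nonneg (P x - P y)).eq_or_lt with h | h
  · rw [← h]; exact norm_nonneg _
  · nlinarith

/-- Hartman–Stampacchia: a continuous map on a nonempty compact convex subset of
`ℝ^k` admits a solution of the associated variational inequality. -/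
theorem stmt_4 (k : ℕ) (hk : 1 ≤ k)
    (D : Set (EuclideanSpace ℝ (Fin k))) (hne : D.Nonempty)
    (hcomp : IsCompact D) (hconv : Convex ℝ D)
    (H : EuclideanSpace ℝ (Fin k) → EuclideanSpace ℝ (Fin k))
    (hcont : ContinuousOn H D) :
    ∃ x ∈ D, ∀ y ∈ D, 0 ≤ ⟪H x, y - x⟫ := by
  obtain ⟨P, hP, hPD, hvar⟩ := hconv.exists_lipschitzWith_projection hne hcomp.isComplete
  obtain ⟨M, hM⟩ := hcomp.exists_bound_of_continuousOn (hcont.sub continuousOn_id)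
  obtain ⟨z, hz⟩ := exists_add_eq_zero_of_continuous_of_bounded
    (g := fun z => H (P z) - P z)
    ((hcont.comp_continuous hP.continuous hPD).sub hP.continuous) fun z => hM (P z) (hPD z)
  refine ⟨P z, hPD z, fun y hy => ?_⟩
  have hH : H (P z) = -(z - P z) := by
    rw [eq_neg_iff_add_eq_zero, ← hz]
    abel
  rw [hH, inner_neg_left]
  exact neg_nonneg.mpr (hvar z y hy)
end

section
/- Let k ≥ 1, let F : ℝ^k → ℝ^k be differentiable, let W be a real k × k matrix, and let D ⊆ ℝ^k be a convex set. Suppose that for every x ∈ D the symmetric part of W · J_F(x) is positive definite, i.e. vᵀ (W · J_F(x)) v > 0 for every nonzero v ∈ ℝ^k, where J_F(x) is the Jacobian matrix of F at x. Then the map x ↦ W (F(x)) is strictly monotone on D, and F has at most one zero in D: if x, y ∈ D satisfy F(x) = 0 and F(y) = 0 then x = y. -/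
open Matrix

/-- The Jacobian matrix of `F : ℝ^k → ℝ^k` at `x`: entry `(i, j)` is the
partial derivative of the `i`-th component of `F` in the `j`-th coordinate
direction. -/
noncomputable def jacobianMatrix (k : ℕ) (F : (Fin k → ℝ) → (Fin k → ℝ))
    (x : Fin k → ℝ) : Matrix (Fin k) (Fin k) ℝ :=
  Matrix.of fun i j => fderiv ℝ F x (Pi.single j 1) i

theorem jacobianMatrix_mulVec (k : ℕ) (F : (Fin k → ℝ) → (Fin k → ℝ)) (x v : Fin k → ℝ) :
    (jacobianMatrix k F x).mulVec v = fderiv ℝ F x v := by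
  have h : jacobianMatrix k F x = LinearMap.toMatrix' (fderiv ℝ F x : (Fin k → ℝ) →ₗ[ℝ] _) := by
    ext i j
    simp [jacobianMatrix, LinearMap.toMatrix'_apply]
  rw [h, LinearMap.toMatrix'_mulVec, ContinuousLinearMap.coe_coe]

/-- If the symmetric part of `W · J_F(x)` is positive definite for every `x` in
a convex set `D`, then `x ↦ W (F x)` is strictly monotone on `D` and `F` has at
most one zero in `D`. -/
theorem stmt_7 (k : ℕ) (hk : 1 ≤ k)
    (F : (Fin k → ℝ) → (Fin k → ℝ)) (hF : Differentiable ℝ F)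
    (W : Matrix (Fin k) (Fin k) ℝ)
    (D : Set (Fin k → ℝ)) (hD : Convex ℝ D)
    (hpos : ∀ x ∈ D, ∀ v : Fin k → ℝ, v ≠ 0 →
      0 < v ⬝ᵥ (W * jacobianMatrix k F x).mulVec v) :
    (∀ x ∈ D, ∀ y ∈ D, x ≠ y →
      0 < (W.mulVec (F x) - W.mulVec (F y)) ⬝ᵥ (x - y)) ∧
    (∀ x ∈ D, ∀ y ∈ D, F x = 0 → F y = 0 → x = y) := by
  have mono : ∀ x ∈ D, ∀ y ∈ D, x ≠ y →
      0 < (W.mulVec (F x) - W.mulVec (F y)) ⬝ᵥ (x - y) := by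
    intro x hx y hy hxy
    let L : (Fin k → ℝ) →L[ℝ] ℝ :=
      LinearMap.toContinuousLinearMap (dotProductBilin ℝ ℝ (x - y) ∘ₗ W.mulVecLin)
    have hL (v : Fin k → ℝ) : L v = (x - y) ⬝ᵥ W.mulVec v := rfl
    obtain ⟨z, hz, h⟩ := domain_mvt (f := fun u => L (F u))
      (f' := fun u => L.comp (fderiv ℝ F u))
      (fun u _ => (L.hasFDerivAt.comp u (hF u).hasFDerivAt).hasFDerivWithinAt) hD hy hx
    have hzpos := hpos z (hD.segment_subset hy hx hz) (x - y) (sub_ne_zero.mpr hxy)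
    rw [← mulVec_mulVec, jacobianMatrix_mulVec] at hzpos
    rw [dotProduct_comm, dotProduct_sub, ← hL, ← hL, h]
    exact hzpos
  refine ⟨mono, fun x hx y hy hFx hFy => ?_⟩
  by_contra hxy
  simpa [hFx, hFy] using mono x hx y hy hxy
end

section
/- For real θ, ρ, the symmetric 2 × 2 matrix M(θ, ρ) = e^ρ · [[cos θ, sin θ], [sin θ, 2 e^ρ − cos θ]] is positive definite if and only if cos θ > (1/2) e^{−ρ}. -/
open Real Matrix

/-- Sylvester's criterion for real symmetric `2 × 2` matrices. -/
theorem posDef_fin_two_iff (a b d : ℝ) :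
    (!![a, b; b, d] : Matrix (Fin 2) (Fin 2) ℝ).PosDef ↔ 0 < a ∧ 0 < a * d - b * b := by
  constructor
  · intro h
    refine ⟨by simpa using h.diag_pos (i := 0), ?_⟩
    simpa [det_fin_two_of] using h.det_pos
  · rintro ⟨ha, hdet⟩
    refine .of_dotProduct_mulVec_pos ?_ fun x hx => ?_
    · ext i j
      fin_cases i <;> fin_cases j <;> simp
    · suffices h : 0 < a * (star x ⬝ᵥ (!![a, b; b, d] *ᵥ x)) from pos_of_mul_pos_right h ha.le
      have hsq : a * (star x ⬝ᵥ (!![a, b; b, d] *ᵥ x)) =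
          (a * x 0 + b * x 1) ^ 2 + (a * d - b * b) * x 1 ^ 2 := by
        simp [dotProduct, mulVec, Fin.sum_univ_two]
        ring
      rw [hsq]
      by_cases h1 : x 1 = 0
      · have h0 : x 0 ≠ 0 := fun h0 => hx (by ext i; fin_cases i <;> simp [h0, h1])
        rw [h1]
        simp only [mul_zero, add_zero, ne_eq, OfNat.ofNat_ne_zero, not_false_eq_true, zero_pow]
        positivity
      · positivity

/-- The scaled two-bus Jacobian `e^ρ [[cos θ, sin θ], [sin θ, 2 e^ρ − cos θ]]`
is positive definite iff `cos θ > (1/2) e^{−ρ}`. -/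
theorem stmt_11 (θ ρ : ℝ) :
    (exp ρ • !![cos θ, sin θ; sin θ, 2 * exp ρ - cos θ] :
      Matrix (Fin 2) (Fin 2) ℝ).PosDef ↔ cos θ > (1 / 2) * exp (-ρ) := by
  have hρ : 0 < exp ρ := exp_pos ρ
  have hstab : cos θ > (1 / 2) * exp (-ρ) ↔ 0 < 2 * exp ρ * cos θ - 1 := by
    rw [exp_neg, gt_iff_lt, ← div_eq_mul_inv, div_lt_iff₀ hρ]
    constructor <;> intro h <;> linarith
  have hdet : exp ρ * cos θ * (exp ρ * (2 * exp ρ - cos θ)) - exp ρ * sin θ * (exp ρ * sin θ) =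
      exp ρ ^ 2 * (2 * exp ρ * cos θ - 1) := by
    linear_combination -exp ρ ^ 2 * sin_sq_add_cos_sq θ
  have hsmul : exp ρ • !![cos θ, sin θ; sin θ, 2 * exp ρ - cos θ] =
      !![exp ρ * cos θ, exp ρ * sin θ; exp ρ * sin θ, exp ρ * (2 * exp ρ - cos θ)] := by
    simp [smul_of]
  rw [hsmul, posDef_fin_two_iff, hdet, hstab, mul_pos_iff_of_pos_left (pow_pos hρ 2)]
  exact ⟨And.right, fun h => ⟨by linarith, h⟩⟩
end

section
/- Fix real parameters g, b, and let J(θ, ρ) = e^ρ · [[b cos θ + g sin θ, 2 g e^ρ − g cos θ + b sin θ], [−g cos θ + b sin θ, 2 b e^ρ − g sin θ − b cos θ]] be the Jacobian matrix of the two-bus power-flow map. Then det J(θ, ρ) = (b² + g²) · e^{2ρ} · (2 e^ρ cos θ − 1). In particular, if (g, b) ≠ (0, 0) then J(θ, ρ) is singular if and only if cos θ = (1/2) e^{−ρ}. -/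
open Real Matrix

/-- The Jacobian matrix of the two-bus power-flow map at `(θ, ρ)`. -/
noncomputable def twoBusJac (g b : ℝ) (θ ρ : ℝ) : Matrix (Fin 2) (Fin 2) ℝ :=
  exp ρ • !![b * cos θ + g * sin θ, 2 * g * exp ρ - g * cos θ + b * sin θ;
             -g * cos θ + b * sin θ, 2 * b * exp ρ - g * sin θ - b * cos θ]

/-- The determinant of the two-bus power-flow Jacobian. -/
theorem det_twoBusJac (g b θ ρ : ℝ) :
    (twoBusJac g b θ ρ).det =
      (b ^ 2 + g ^ 2) * exp (2 * ρ) * (2 * exp ρ * cos θ - 1) := by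
  have hexp : exp (2 * ρ) = exp ρ ^ 2 := by rw [two_mul, exp_add, sq]
  rw [twoBusJac, det_smul, det_fin_two_of, Fintype.card_fin, hexp]
  linear_combination (-(b ^ 2 + g ^ 2) * exp ρ ^ 2) * sin_sq_add_cos_sq θ

/-- `det J(θ, ρ) = (b² + g²) e^{2ρ} (2 e^ρ cos θ − 1)`; in particular, if
`(g, b) ≠ (0, 0)` then `J(θ, ρ)` is singular iff `cos θ = (1/2) e^{−ρ}`. -/
theorem stmt_12 (g b θ ρ : ℝ) :
    (twoBusJac g b θ ρ).det = (b ^ 2 + g ^ 2) * exp (2 * ρ) * (2 * exp ρ * cos θ - 1) ∧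
    ((g, b) ≠ (0, 0) →
      (¬ IsUnit (twoBusJac g b θ ρ) ↔ cos θ = (1 / 2) * exp (-ρ))) := by
  refine ⟨det_twoBusJac g b θ ρ, fun hgb => ?_⟩
  have hpos : b ^ 2 + g ^ 2 ≠ 0 := by
    contrapose! hgb
    have hb : b = 0 := by nlinarith [sq_nonneg b, sq_nonneg g]
    have hg : g = 0 := by nlinarith [sq_nonneg b, sq_nonneg g]
    rw [hb, hg]
  have hρ : exp ρ ≠ 0 := exp_ne_zero ρ
  rw [isUnit_iff_isUnit_det, isUnit_iff_ne_zero, not_not, det_twoBusJac,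
    mul_eq_zero_iff_left (mul_ne_zero hpos (exp_ne_zero _)), exp_neg, sub_eq_zero]
  field_simp
end

section
/- Fix real parameters g, b with (g, b) ≠ (0, 0), and let F : ℝ² → ℝ² be the two-bus power-flow map F(θ, ρ) = (b e^ρ sin θ − g e^ρ cos θ + g e^{2ρ}, −g e^ρ sin θ − b e^ρ cos θ + b e^{2ρ}). Let D ⊆ {(θ, ρ) ∈ ℝ² : cos θ > (1/2) e^{−ρ}} be a convex set, and let W = (1/(b² + g²)) · [[b, −g], [g, b]]. Then the map (θ, ρ) ↦ W · F(θ, ρ) is strictly monotone on D, and consequently for any fixed injections (p, q) ∈ ℝ², the power-flow equations F(θ, ρ) = (p, q) have at most one solution (θ, ρ) ∈ D. -/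
open Real Matrix

/-- The two-bus power-flow map `F(θ, ρ)`, with `x 0 = θ` (phase) and
`x 1 = ρ` (log voltage magnitude). -/
noncomputable def twoBusPF (g b : ℝ) : (Fin 2 → ℝ) → (Fin 2 → ℝ) := fun x =>
  ![b * exp (x 1) * sin (x 0) - g * exp (x 1) * cos (x 0) + g * exp (2 * x 1),
    -g * exp (x 1) * sin (x 0) - b * exp (x 1) * cos (x 0) + b * exp (2 * x 1)]

/-- Multiplying by `W` removes the line parameters from the two-bus power-flow map. -/
theorem scaled_twoBusPF {g b : ℝ} (h : (g, b) ≠ (0, 0)) (x : Fin 2 → ℝ) :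
    ((b ^ 2 + g ^ 2)⁻¹ • !![b, -g; g, b]).mulVec (twoBusPF g b x) =
      ![exp (x 1) * sin (x 0), exp (x 1) ^ 2 - exp (x 1) * cos (x 0)] := by
  have hne : b ^ 2 + g ^ 2 ≠ 0 := by
    intro h0
    apply h
    have hb : b = 0 := by nlinarith [sq_nonneg b, sq_nonneg g]
    have hg : g = 0 := by nlinarith [sq_nonneg b, sq_nonneg g]
    rw [hb, hg]
  have hexp : exp (2 * x 1) = exp (x 1) ^ 2 := by
    rw [two_mul, exp_add, sq]
  ext i
  fin_cases i <;>
  · simp [twoBusPF, Matrix.mulVec, dotProduct, Fin.sum_univ_two, hexp]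
    field_simp
    ring

/-- The Jacobian of the scaled map is positive definite where `2 e^ρ cos θ > 1`. -/
theorem scaled_jacobian_quadratic_form_pos {E c s u v : ℝ} (hE : 0 < E) (hc : 0 < c)
    (hEc : 1 < 2 * E * c) (hcs : s ^ 2 + c ^ 2 = 1) (huv : u ≠ 0 ∨ v ≠ 0) :
    0 < E * (c * u ^ 2 + 2 * s * u * v + (2 * E - c) * v ^ 2) := by
  refine mul_pos hE (pos_of_mul_pos_right (a := c) ?_ hc.le)
  have hsq : c * (c * u ^ 2 + 2 * s * u * v + (2 * E - c) * v ^ 2) =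
      (c * u + s * v) ^ 2 + (2 * E * c - 1) * v ^ 2 := by
    linear_combination (-v ^ 2) * hcs
  rw [hsq]
  by_cases hv : v = 0
  · have hu : u ≠ 0 := huv.resolve_right (not_not.mpr hv)
    subst hv
    have : 0 < (c * u) ^ 2 := by positivity
    simpa using this
  · have : 0 < (2 * E * c - 1) * v ^ 2 := mul_pos (by linarith) (by positivity)
    linarith [sq_nonneg (c * u + s * v)]

/-- Derivative of the scaled map along the line through `(θ, ρ)` with direction `(u, v)`,
paired with that direction. -/
theorem hasDerivAt_scaled_along_line (θ ρ u v t : ℝ) :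
    HasDerivAt
      (fun t => exp (ρ + t * v) * sin (θ + t * u) * u +
        (exp (ρ + t * v) ^ 2 - exp (ρ + t * v) * cos (θ + t * u)) * v)
      (exp (ρ + t * v) * (cos (θ + t * u) * u ^ 2 + 2 * sin (θ + t * u) * u * v +
        (2 * exp (ρ + t * v) - cos (θ + t * u)) * v ^ 2)) t := by
  have hθ : HasDerivAt (fun t => θ + t * u) u t := by
    simpa using ((hasDerivAt_id t).mul_const u).const_add θ
  have hρ : HasDerivAt (fun t => ρ + t * v) v t := by
    simpa using ((hasDerivAt_id t).mul_const v).const_add ρ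
  refine (((hρ.exp.mul hθ.sin).mul_const u).add
    (((hρ.exp.pow 2).sub (hρ.exp.mul hθ.cos)).mul_const v)).congr_deriv ?_
  push_cast
  ring

theorem scaled_twoBusPF_strictly_monotone {g b : ℝ} (h : (g, b) ≠ (0, 0))
    {D : Set (Fin 2 → ℝ)} (hconv : Convex ℝ D)
    (hsub : ∀ x ∈ D, cos (x 0) > (1 / 2) * exp (-(x 1)))
    {x y : Fin 2 → ℝ} (hx : x ∈ D) (hy : y ∈ D) (hxy : x ≠ y) :
    0 < (((b ^ 2 + g ^ 2)⁻¹ • !![b, -g; g, b]).mulVec (twoBusPF g b x) -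
      ((b ^ 2 + g ^ 2)⁻¹ • !![b, -g; g, b]).mulVec (twoBusPF g b y)) ⬝ᵥ (x - y) := by
  have huv : x 0 - y 0 ≠ 0 ∨ x 1 - y 1 ≠ 0 := by
    by_contra! hzero
    apply hxy
    ext i
    fin_cases i
    · exact sub_eq_zero.mp hzero.1
    · exact sub_eq_zero.mp hzero.2
  have hderiv := hasDerivAt_scaled_along_line (y 0) (y 1) (x 0 - y 0) (x 1 - y 1)
  have hmono := strictMonoOn_of_deriv_pos (convex_Icc (0 : ℝ) 1)
    (fun t _ => (hderiv t).continuousAt.continuousWithinAt) (fun t ht => by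
      rw [(hderiv t).deriv]
      have hmem := hsub _ (hconv.add_smul_sub_mem hy hx (interior_subset ht))
      simp only [Pi.add_apply, Pi.smul_apply, Pi.sub_apply, smul_eq_mul] at hmem
      have hE := exp_pos (y 1 + t * (x 1 - y 1))
      rw [exp_neg] at hmem
      refine scaled_jacobian_quadratic_form_pos hE (lt_trans (by positivity) hmem) ?_
        (sin_sq_add_cos_sq _) huv
      have hmul := mul_lt_mul_of_pos_left hmem hE
      have hinv := mul_inv_cancel₀ hE.ne'
      linarith)
  have hlt := hmono (Set.left_mem_Icc.mpr zero_le_one) (Set.right_mem_Icc.mpr zero_le_one)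
    zero_lt_one
  simp only [zero_mul, one_mul, add_zero, add_sub_cancel] at hlt
  rw [scaled_twoBusPF h, scaled_twoBusPF h]
  simp only [dotProduct, Fin.sum_univ_two, Pi.sub_apply, cons_val_zero, cons_val_one]
  linarith

/-- On any convex subset of `{(θ, ρ) : cos θ > (1/2) e^{−ρ}}`, the scaled
two-bus power-flow map `W·F` is strictly monotone, and hence the power-flow
equations `F(θ, ρ) = (p, q)` have at most one solution in `D`. -/
theorem stmt_13 (g b : ℝ) (h : (g, b) ≠ (0, 0))
    (D : Set (Fin 2 → ℝ)) (hconv : Convex ℝ D)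
    (hsub : ∀ x ∈ D, cos (x 0) > (1 / 2) * exp (-(x 1))) :
    (∀ x ∈ D, ∀ y ∈ D, x ≠ y →
      0 < (((b ^ 2 + g ^ 2)⁻¹ • !![b, -g; g, b]).mulVec (twoBusPF g b x) -
            ((b ^ 2 + g ^ 2)⁻¹ • !![b, -g; g, b]).mulVec (twoBusPF g b y)) ⬝ᵥ (x - y)) ∧
    (∀ p q : ℝ, ∀ x ∈ D, ∀ y ∈ D,
      twoBusPF g b x = ![p, q] → twoBusPF g b y = ![p, q] → x = y) := by
  have hmono := fun x hx y hy =>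
    scaled_twoBusPF_strictly_monotone h hconv hsub (x := x) (y := y) hx hy
  refine ⟨hmono, fun p q x hx y hy hpx hpy => ?_⟩
  by_contra hxy
  have hpos := hmono x hx y hy hxy
  rw [hpx, hpy, sub_self, zero_dotProduct] at hpos
  exact lt_irrefl 0 hpos
end

section
/- For every real γ > 0, the set {(θ, ρ₁, ρ₂) ∈ ℝ³ : |θ| ≤ π/2 and cos θ ≥ γ · e^{|ρ₁ − ρ₂|}} is convex. -/
open Real

/-- For every `γ > 0`, the single-line monotonicity domain
`{(θ, ρ₁, ρ₂) : |θ| ≤ π/2 and cos θ ≥ γ e^{|ρ₁ − ρ₂|}}` is convex. -/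
theorem stmt_15 (γ : ℝ) (hγ : 0 < γ) :
    Convex ℝ {p : ℝ × ℝ × ℝ |
      |p.1| ≤ π / 2 ∧ γ * exp |p.2.1 - p.2.2| ≤ cos p.1} := by
  rintro ⟨θ, ρ₁, ρ₂⟩ ⟨hθ, hρ⟩ ⟨θ', ρ₁', ρ₂'⟩ ⟨hθ', hρ'⟩ a b ha hb hab
  simp only [abs_le] at hθ hθ'
  simp only [Set.mem_ofPred_eq, Prod.smul_mk, Prod.mk_add_mk, smul_eq_mul] at hρ hρ' ⊢
  have hcos := strictConcaveOn_cos_Icc.concaveOn.2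
    (show θ ∈ Set.Icc (-(π / 2)) (π / 2) from hθ) hθ' ha hb hab
  have hexp := convexOn_exp.2 (Set.mem_univ |ρ₁ - ρ₂|) (Set.mem_univ |ρ₁' - ρ₂'|) ha hb hab
  simp only [smul_eq_mul] at hcos hexp
  have habs : |a * ρ₁ + b * ρ₁' - (a * ρ₂ + b * ρ₂')| ≤ a * |ρ₁ - ρ₂| + b * |ρ₁' - ρ₂'| :=
    calc |a * ρ₁ + b * ρ₁' - (a * ρ₂ + b * ρ₂')|
        = |a * (ρ₁ - ρ₂) + b * (ρ₁' - ρ₂')| := by ring_nf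
      _ ≤ |a * (ρ₁ - ρ₂)| + |b * (ρ₁' - ρ₂')| := abs_add_le _ _
      _ = a * |ρ₁ - ρ₂| + b * |ρ₁' - ρ₂'| := by
        rw [abs_mul, abs_mul, abs_of_nonneg ha, abs_of_nonneg hb]
  refine ⟨abs_le.2 (convex_Icc (-(π / 2)) (π / 2) hθ hθ' ha hb hab), ?_⟩
  calc γ * exp |a * ρ₁ + b * ρ₁' - (a * ρ₂ + b * ρ₂')|
      ≤ γ * (a * exp |ρ₁ - ρ₂| + b * exp |ρ₁' - ρ₂'|) := by
        gcongr
        exact (exp_le_exp.2 habs).trans hexp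
    _ = a * (γ * exp |ρ₁ - ρ₂|) + b * (γ * exp |ρ₁' - ρ₂'|) := by ring
    _ ≤ a * cos θ + b * cos θ' := by gcongr
    _ ≤ cos (a * θ + b * θ') := hcos
end
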